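/- For every natural number n and all nonnegative real numbers c_0, c_1, …, c_{n+1}, not all zero, the polynomial Σ_{k=0}^{n+1} c_k p^B_{n,k}(x) is real-rooted and is interlaced by the type B Eulerian polynomial B_n(x). -/

import Mathlib

open Polynomial PowerSeries

/-- The polynomials `p^B_{n,k}` defined recursively as in
Proposition (e): `p^B_{0,0} = 1`, `p^B_{0,1} = x`,
`p^B_{n+1,0} = ∑_{i=0}^{n+1} p^B_{n,i}`,
`p^B_{n+1,k} = 2x ∑_{i=0}^{k-1} p^B_{n,i} + 2 ∑_{i=k}^{n+1} p^B_{n,i}` for `1 ≤ k ≤ n+1`, and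
`p^B_{n+1,n+2} = x ∑_{i=0}^{n+1} p^B_{n,i}`. -/
noncomputable def pB : ℕ → ℕ → Polynomial ℝ
  | 0, 0 => 1
  | 0, 1 => Polynomial.X
  | 0, _ + 2 => 0
  | n + 1, 0 => ∑ i ∈ Finset.range (n + 2), pB n i
  | n + 1, k + 1 =>
      if k + 1 ≤ n + 1 then
        2 * Polynomial.X * (∑ i ∈ Finset.range (k + 1), pB n i) +
          2 * ∑ i ∈ Finset.Icc (k + 1) (n + 1), pB n i
      else if k + 1 = n + 2 then
        Polynomial.X * ∑ i ∈ Finset.range (n + 2), pB n i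
      else 0
  termination_by n _ => n

/-- A real polynomial is *real-rooted* if all of its complex roots are real. -/
def RealRooted (p : Polynomial ℝ) : Prop :=
  ∀ z : ℂ, Polynomial.aeval z p = 0 → z.im = 0

/-- The list of real roots of `p` (with multiplicity), in decreasing order. -/
noncomputable def rootsDesc (p : Polynomial ℝ) : List ℝ :=
  (p.roots.sort (· ≤ ·)).reverse

/-- `Interlaces p q` means: `p` and `q` are nonzero real-rooted polynomials (all complex
roots are real, i.e. each has as many real roots, with multiplicity, as its degree), all
their roots are nonpositive, and listing the roots `α₁ ≥ α₂ ≥ ⋯` of `p` and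
`β₁ ≥ β₂ ≥ ⋯` of `q` with multiplicity in decreasing order, they alternate as
`⋯ ≤ β₃ ≤ α₂ ≤ β₂ ≤ α₁ ≤ β₁ ≤ 0` (in particular `deg p ≤ deg q ≤ deg p + 1`). -/
def Interlaces (p q : Polynomial ℝ) : Prop :=
  p ≠ 0 ∧ q ≠ 0 ∧
  p.roots.card = p.natDegree ∧ q.roots.card = q.natDegree ∧
  p.natDegree ≤ q.natDegree ∧ q.natDegree ≤ p.natDegree + 1 ∧
  (∀ x ∈ p.roots, x ≤ 0) ∧ (∀ x ∈ q.roots, x ≤ 0) ∧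
  (∀ (i : ℕ) (hip : i < (rootsDesc p).length) (hiq : i < (rootsDesc q).length),
      (rootsDesc p).get ⟨i, hip⟩ ≤ (rootsDesc q).get ⟨i, hiq⟩) ∧
  (∀ (i : ℕ) (hiq : i + 1 < (rootsDesc q).length) (hip : i < (rootsDesc p).length),
      (rootsDesc q).get ⟨i + 1, hiq⟩ ≤ (rootsDesc p).get ⟨i, hip⟩)

open Filter Topology
open scoped ComplexConjugate

theorem pB_succ_eq_C_mul (n k : ℕ) (hk : k ≤ n + 2) :
    pB (n + 1) k = Polynomial.C (if k = 0 ∨ k = n + 2 then (1 : ℝ) else 2) *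
      (Polynomial.X * ∑ i ∈ Finset.range k, pB n i + ∑ i ∈ Finset.Ico k (n + 2), pB n i) := by
  rcases k with _ | k
  · simp [pB]
  · rw [pB]
    by_cases h : k + 1 ≤ n + 1
    · have h' : k ≠ n + 1 := by omega
      have hI : Finset.Icc (k + 1) (n + 1) = Finset.Ico (k + 1) (n + 2) := by
        ext; simp only [Finset.mem_Icc, Finset.mem_Ico]; omega
      have h2 : (Polynomial.C (2 : ℝ)) = 2 := rfl
      simp only [h, if_true, hI, Nat.add_eq_zero_iff, one_ne_zero, and_false, false_or,
        Nat.reduceEqDiff, h', if_false, h2]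
      ring
    · obtain rfl : k = n + 1 := by omega
      simp

theorem pB_coeff_nonneg (n : ℕ) : ∀ k m, 0 ≤ (pB n k).coeff m := by
  induction n with
  | zero =>
    intro k m
    rcases k with _ | _ | k
    · rw [pB, Polynomial.coeff_one]; split_ifs <;> norm_num
    · rw [pB, Polynomial.coeff_X]; split_ifs <;> norm_num
    · simp [pB]
  | succ n ih =>
    intro k m
    by_cases hk : k ≤ n + 2
    · rw [pB_succ_eq_C_mul n k hk, Polynomial.coeff_C_mul, Polynomial.coeff_add]
      refine mul_nonneg (by split_ifs <;> norm_num) (add_nonneg ?_ ?_)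
      · rcases m with _ | m
        · simp
        · rw [Polynomial.coeff_X_mul, Polynomial.finsetSum_coeff]
          exact Finset.sum_nonneg fun i _ => ih i m
      · rw [Polynomial.finsetSum_coeff]
        exact Finset.sum_nonneg fun i _ => ih i m
    · obtain ⟨k, rfl⟩ : ∃ j, k = j + 1 := ⟨k - 1, by omega⟩
      rw [pB, if_neg (by omega), if_neg (by omega), Polynomial.coeff_zero]

theorem pB_succ_zero (n : ℕ) : pB (n + 1) 0 = ∑ i ∈ Finset.range (n + 2), pB n i := by
  simp [pB]

theorem pB_succ_one (n : ℕ) :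
    pB (n + 1) 1 = 2 * pB (n + 1) 0 - 2 * (1 - Polynomial.X) * pB n 0 := by
  have h2 : (Polynomial.C (2 : ℝ)) = 2 := rfl
  rw [pB_succ_zero, Finset.range_eq_Ico, Finset.sum_eq_sum_Ico_succ_bot (by omega),
    pB_succ_eq_C_mul n 1 (by omega)]
  simp [h2]
  ring

theorem pB_succ_succ (n k : ℕ) (hk : k < n) :
    pB (n + 1) (k + 2) = pB (n + 1) (k + 1) - 2 * (1 - Polynomial.X) * pB n (k + 1) := by
  have h2 : (Polynomial.C (2 : ℝ)) = 2 := rfl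
  rw [pB_succ_eq_C_mul n (k + 1) (by omega), pB_succ_eq_C_mul n (k + 2) (by omega),
    Finset.sum_eq_sum_Ico_succ_bot (show k + 1 < n + 2 by omega),
    Finset.sum_range_succ _ (k + 1), if_neg (by omega), if_neg (by omega), h2]
  ring

theorem pB_succ_last (n : ℕ) : pB (n + 1) (n + 2) = Polynomial.X * pB (n + 1) 0 := by
  rw [pB_succ_zero, pB_succ_eq_C_mul n (n + 2) le_rfl]
  simp

theorem pB_coe_powerSeries (n : ℕ) :
    ((pB n 0 : Polynomial ℝ) : PowerSeries ℝ) =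
        (1 - PowerSeries.X) ^ (n + 1) * PowerSeries.mk (fun m => (2 * m + 1 : ℝ) ^ n) ∧
      (∀ k < n, ((pB n (k + 1) : Polynomial ℝ) : PowerSeries ℝ) =
        (1 - PowerSeries.X) ^ (n + 1) * PowerSeries.mk
          (fun m => 4 * m * ((2 * m - 1 : ℝ) ^ k * (2 * m + 1 : ℝ) ^ (n - 1 - k)))) ∧
      ((pB n (n + 1) : Polynomial ℝ) : PowerSeries ℝ) =
        (1 - PowerSeries.X) ^ (n + 1) *
          (PowerSeries.X * PowerSeries.mk (fun m => (2 * m + 1 : ℝ) ^ n)) := by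
  induction n with
  | zero =>
    have h : (1 - PowerSeries.X) * PowerSeries.mk (fun _ => (1 : ℝ)) = 1 := by
      rw [mul_comm]; exact PowerSeries.mk_one_mul_one_sub_eq_one ℝ
    refine ⟨by simpa [pB] using h.symm, by simp, ?_⟩
    simp only [pB, Polynomial.coe_X, zero_add, pow_one, pow_zero]
    rw [mul_left_comm, h, mul_one]
  | succ n ih =>
    obtain ⟨h0, hmid, hlast⟩ := ih
    have hzero : ((pB (n + 1) 0 : Polynomial ℝ) : PowerSeries ℝ) =
        (1 - PowerSeries.X) ^ (n + 1 + 1) *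
          PowerSeries.mk (fun m => (2 * m + 1 : ℝ) ^ (n + 1)) := by
      rw [pB_succ_zero, ← Polynomial.coeToPowerSeries.ringHom_apply, map_sum,
        Finset.sum_range_succ, Finset.sum_range_succ']
      simp only [Polynomial.coeToPowerSeries.ringHom_apply]
      rw [Finset.sum_congr rfl fun k hk => hmid k (Finset.mem_range.1 hk), h0, hlast,
        ← Finset.mul_sum, ← mul_add, ← mul_add, pow_succ _ (n + 1), mul_assoc]
      congr 1
      ext m
      rw [sub_mul, one_mul]
      have hg := geom_sum₂_mul (2 * m - 1 : ℝ) (2 * m + 1) n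
      have hs : ∑ k ∈ Finset.range n, 4 * (m : ℝ) *
          ((2 * m - 1 : ℝ) ^ k * (2 * m + 1 : ℝ) ^ (n - 1 - k)) =
          2 * m * ((2 * m + 1) ^ n - (2 * m - 1) ^ n) := by
        rw [← Finset.mul_sum]
        linear_combination (-2 * (m : ℝ)) * hg
      simp only [map_add, map_sub, map_sum, PowerSeries.coeff_mk]
      rw [hs]
      rcases m with _ | m
      · simp
      · simp only [PowerSeries.coeff_succ_X_mul, PowerSeries.coeff_mk]
        push_cast
        ring
    refine ⟨hzero, ?_, ?_⟩
    · intro k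
      induction k with
      | zero =>
        intro _
        rw [pB_succ_one, Polynomial.coe_sub, Polynomial.coe_mul, Polynomial.coe_mul, hzero,
          Polynomial.coe_mul, h0, Polynomial.coe_sub, Polynomial.coe_X, Polynomial.coe_one]
        have h2 : ((2 : Polynomial ℝ) : PowerSeries ℝ) = PowerSeries.C 2 := Polynomial.coe_C 2
        rw [h2, show ∀ a s u v : PowerSeries ℝ, a * (s ^ (n + 1 + 1) * u) -
          a * s * (s ^ (n + 1) * v) = s ^ (n + 1 + 1) * (a * (u - v)) from fun _ _ _ _ => by ring]
        congr 1
        ext m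
        simp only [PowerSeries.coeff_C_mul, map_sub, PowerSeries.coeff_mk]
        simp
        ring
      | succ k ihk =>
        intro hk
        rw [pB_succ_succ n k (by omega), Polynomial.coe_sub, Polynomial.coe_mul,
          Polynomial.coe_mul, ihk (by omega), hmid k (by omega),
          Polynomial.coe_sub, Polynomial.coe_X, Polynomial.coe_one]
        have h2 : ((2 : Polynomial ℝ) : PowerSeries ℝ) = PowerSeries.C 2 := Polynomial.coe_C 2
        rw [h2, show ∀ a s u v : PowerSeries ℝ, s ^ (n + 1 + 1) * u -
          a * s * (s ^ (n + 1) * v) = s ^ (n + 1 + 1) * (u - a * v) from fun _ _ _ _ => by ring]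
        congr 1
        ext m
        simp only [PowerSeries.coeff_C_mul, map_sub, PowerSeries.coeff_mk]
        obtain ⟨j, rfl⟩ : ∃ j, n = k + 1 + j := ⟨n - (k + 1), by omega⟩
        rw [show k + 1 + j + 1 - 1 - k = j + 1 by omega, show k + 1 + j - 1 - k = j by omega,
          show k + 1 + j + 1 - 1 - (k + 1) = j by omega]
        ring
    · rw [pB_succ_last, Polynomial.coe_mul, hzero, Polynomial.coe_X]
      ring

theorem pB_zero_eq_of_coe_eq {n : ℕ} {B : Polynomial ℝ}
    (hB : (B : PowerSeries ℝ) =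
      (1 - PowerSeries.X) ^ (n + 1) * PowerSeries.mk (fun m => ((2 * m + 1 : ℝ)) ^ n)) :
    B = pB n 0 :=
  Polynomial.coe_injective ℝ (hB.trans (pB_coe_powerSeries n).1.symm)

/-- All values `f i` with `i < N` are nonzero and, for `i ≤ j < N`, the argument of `f j / f i`
lies between `0` and the argument of `z`. -/
structure IsSectorSeq (z : ℂ) (N : ℕ) (f : ℕ → ℂ) : Prop where
  ne_zero : ∀ i < N, f i ≠ 0
  im_nonneg : ∀ i j, i ≤ j → j < N → 0 ≤ (f j * conj (f i)).im
  im_mul_nonneg : ∀ i j, i ≤ j → j < N → 0 ≤ (z * f i * conj (f j)).im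

namespace IsSectorSeq

variable {z : ℂ} {N : ℕ} {f : ℕ → ℂ}

theorem sum_im_nonneg (h : IsSectorSeq z N f) {s t : Finset ℕ}
    (hst : ∀ i ∈ s, ∀ j ∈ t, i ≤ j ∧ j < N) :
    0 ≤ ((∑ j ∈ t, f j) * conj (∑ i ∈ s, f i)).im := by
  rw [map_sum, Finset.sum_mul_sum, Complex.im_sum]
  refine Finset.sum_nonneg fun j hj => ?_
  rw [Complex.im_sum]
  exact Finset.sum_nonneg fun i hi => h.im_nonneg i j (hst i hi j hj).1 (hst i hi j hj).2

theorem sum_im_mul_nonneg (h : IsSectorSeq z N f) {s t : Finset ℕ}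
    (hst : ∀ i ∈ s, ∀ j ∈ t, i ≤ j ∧ j < N) :
    0 ≤ (z * (∑ i ∈ s, f i) * conj (∑ j ∈ t, f j)).im := by
  rw [map_sum, mul_assoc, Finset.sum_mul_sum, Finset.mul_sum, Complex.im_sum]
  refine Finset.sum_nonneg fun i hi => ?_
  rw [Finset.mul_sum, Complex.im_sum]
  refine Finset.sum_nonneg fun j hj => ?_
  rw [← mul_assoc]
  exact h.im_mul_nonneg i j (hst i hi j hj).1 (hst i hi j hj).2

theorem sum_smul_ne_zero (h : IsSectorSeq z N f) (hz : 0 < z.im) {s : Finset ℕ}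
    (hs : ∀ i ∈ s, i < N) {a : ℕ → ℝ} (ha : ∀ i ∈ s, 0 ≤ a i) (ha' : ∃ i ∈ s, a i ≠ 0) :
    ∑ i ∈ s, (a i : ℂ) * f i ≠ 0 := by
  intro h0
  obtain ⟨i₀, hi₀, hai₀⟩ := ha'
  have hN : 0 < N := (Nat.zero_le _).trans_lt (hs i₀ hi₀)
  let L : ℂ → ℝ := fun w => (w * conj (f 0)).im + (z * f 0 * conj w).im
  have hL : ∀ i ∈ s, 0 < L (f i) := by
    intro i hi
    have h1 := h.im_nonneg 0 i (Nat.zero_le _) (hs i hi)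
    have h2 := h.im_mul_nonneg 0 i (Nat.zero_le _) (hs i hi)
    refine lt_of_le_of_ne (add_nonneg h1 h2) fun h3 => ?_
    have h4 : (f i * conj (f 0)).im = 0 := by simp only [L] at h3; linarith
    have h5 : (z * f 0 * conj (f i)).im = 0 := by simp only [L] at h3; linarith
    have h6 : (z * f 0 * conj (f i)).im = z.im * (f i * conj (f 0)).re -
        z.re * (f i * conj (f 0)).im := by
      simp only [Complex.mul_im, Complex.mul_re, Complex.conj_re, Complex.conj_im]; ring
    rw [h5, h4, mul_zero, sub_zero] at h6
    have h7 : (f i * conj (f 0)).re = 0 := by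
      rcases mul_eq_zero.1 h6.symm with h | h
      · exact absurd h hz.ne'
      · exact h
    have h8 : f i * conj (f 0) = 0 := Complex.ext h7 h4
    rcases mul_eq_zero.1 h8 with h | h'
    · exact ‹IsSectorSeq z N f›.ne_zero i (hs i hi) h
    · exact h.ne_zero 0 hN (by simpa using h')
  have hsum : L (∑ i ∈ s, (a i : ℂ) * f i) = ∑ i ∈ s, a i * L (f i) := by
    simp only [L, map_sum, Finset.sum_mul, Finset.mul_sum, Complex.im_sum,
      ← Finset.sum_add_distrib]
    refine Finset.sum_congr rfl fun i _ => ?_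
    simp only [map_mul, Complex.conj_ofReal, Complex.mul_im, Complex.mul_re, Complex.conj_re,
      Complex.conj_im, Complex.ofReal_re, Complex.ofReal_im]
    ring
  have hpos : 0 < ∑ i ∈ s, a i * L (f i) :=
    Finset.sum_pos' (fun i hi => mul_nonneg (ha i hi) (hL i hi).le)
      ⟨i₀, hi₀, mul_pos (lt_of_le_of_ne (ha i₀ hi₀) hai₀.symm) (hL i₀ hi₀)⟩
  rw [← hsum, h0] at hpos
  simp [L] at hpos

theorem sum_ne_zero (h : IsSectorSeq z N f) (hz : 0 < z.im) {s : Finset ℕ}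
    (hs : ∀ i ∈ s, i < N) (hne : s.Nonempty) : ∑ i ∈ s, f i ≠ 0 := by
  simpa using h.sum_smul_ne_zero hz hs (a := fun _ => 1) (fun _ _ => zero_le_one)
    (hne.imp fun _ hi => ⟨hi, one_ne_zero⟩)

theorem step (h : IsSectorSeq z N f) (hz : 0 < z.im) (hN : 0 < N) {a : ℕ → ℝ}
    (ha : ∀ k, 0 < a k) :
    IsSectorSeq z (N + 1)
      (fun k => (a k : ℂ) * (z * ∑ i ∈ Finset.range k, f i + ∑ i ∈ Finset.Ico k N, f i)) := by
  have scale : ∀ (r s : ℝ) (u v : ℂ), ((r : ℂ) * u * conj ((s : ℂ) * v)).im =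
      r * s * (u * conj v).im := by
    intro r s u v
    simp only [map_mul, Complex.conj_ofReal, Complex.mul_im, Complex.mul_re, Complex.conj_re,
      Complex.conj_im, Complex.ofReal_re, Complex.ofReal_im]
    ring
  have key : ∀ k l, k ≤ l → l < N + 1 → ∃ A M C : ℂ,
      ∑ i ∈ Finset.range k, f i = A ∧ ∑ i ∈ Finset.Ico k N, f i = M + C ∧
      ∑ i ∈ Finset.range l, f i = A + M ∧ ∑ i ∈ Finset.Ico l N, f i = C ∧
      0 ≤ (M * conj A).im ∧ 0 ≤ (C * conj M).im ∧
      0 ≤ (z * A * conj M).im ∧ 0 ≤ (z * M * conj C).im := by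
    intro k l hkl hl
    refine ⟨∑ i ∈ Finset.range k, f i, ∑ i ∈ Finset.Ico k l, f i, ∑ i ∈ Finset.Ico l N, f i,
      rfl, (Finset.sum_Ico_consecutive f hkl (by omega)).symm,
      (Finset.sum_range_add_sum_Ico f hkl).symm, rfl, ?_, ?_, ?_, ?_⟩
    · refine h.sum_im_nonneg fun i hi j hj => ?_
      simp only [Finset.mem_range, Finset.mem_Ico] at hi hj; omega
    · refine h.sum_im_nonneg fun i hi j hj => ?_
      simp only [Finset.mem_Ico] at hi hj; omega
    · refine h.sum_im_mul_nonneg fun i hi j hj => ?_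
      simp only [Finset.mem_range, Finset.mem_Ico] at hi hj; omega
    · refine h.sum_im_mul_nonneg fun i hi j hj => ?_
      simp only [Finset.mem_Ico] at hi hj; omega
  refine ⟨fun k hk => ?_, fun k l hkl hl => ?_, fun k l hkl hl => ?_⟩
  · refine mul_ne_zero (Complex.ofReal_ne_zero.2 (ha k).ne') fun h0 => ?_
    have hz0 : z ≠ 0 := by rintro rfl; simp at hz
    rcases Nat.eq_zero_or_pos k with rfl | hk0
    · simp only [Finset.range_zero, Finset.sum_empty, mul_zero, zero_add] at h0
      exact h.sum_ne_zero hz (fun i hi => (Finset.mem_Ico.1 hi).2) ⟨0, by simp [hN]⟩ h0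
    · have hA : ∑ i ∈ Finset.range k, f i ≠ 0 :=
        h.sum_ne_zero hz (fun i hi => by have := Finset.mem_range.1 hi; omega)
          ⟨0, by simp [hk0]⟩
      have hCA : 0 ≤ ((∑ i ∈ Finset.Ico k N, f i) * conj (∑ i ∈ Finset.range k, f i)).im := by
        refine h.sum_im_nonneg fun i hi j hj => ?_
        simp only [Finset.mem_range, Finset.mem_Ico] at hi hj; omega
      rw [← neg_eq_iff_add_eq_zero.2 h0, neg_mul, mul_assoc, Complex.mul_conj, Complex.neg_im,
        Complex.mul_im] at hCA
      simp only [Complex.ofReal_im, Complex.ofReal_re, mul_zero, zero_add] at hCA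
      have := mul_pos hz (Complex.normSq_pos.2 hA)
      linarith
  · obtain ⟨A, M, C, h1, h2, h3, h4, hMA, hCM, hAM, hMC⟩ := key k l hkl hl
    rw [scale, h1, h2, h3, h4]
    refine mul_nonneg (mul_nonneg (ha l).le (ha k).le) ?_
    have : ((z * (A + M) + C) * conj (z * A + (M + C))).im =
        Complex.normSq z * (M * conj A).im + (z * A * conj M).im + z.im * Complex.normSq M +
          (z * M * conj C).im + (C * conj M).im := by
      simp only [map_add, map_mul, Complex.normSq_apply, Complex.add_im, Complex.add_re,
        Complex.mul_im, Complex.mul_re, Complex.conj_re, Complex.conj_im]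
      ring
    rw [this]
    have := mul_nonneg (Complex.normSq_nonneg z) hMA
    have := mul_nonneg hz.le (Complex.normSq_nonneg M)
    linarith
  · obtain ⟨A, M, C, h1, h2, h3, h4, hMA, hCM, hAM, hMC⟩ := key k l hkl hl
    rw [mul_left_comm, scale, h1, h2, h3, h4]
    refine mul_nonneg (mul_nonneg (ha k).le (ha l).le) ?_
    have : (z * (z * A + (M + C)) * conj (z * (A + M) + C)).im =
        Complex.normSq z * ((z * A * conj M).im + (M * conj A).im + (C * conj M).im) +
          (z * M * conj C).im + z.im * Complex.normSq (z * A + C) := by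
      simp only [map_add, map_mul, Complex.normSq_apply, Complex.add_im, Complex.add_re,
        Complex.mul_im, Complex.mul_re, Complex.conj_re, Complex.conj_im]
      ring
    rw [this]
    have := mul_nonneg (Complex.normSq_nonneg z) (add_nonneg (add_nonneg hAM hMA) hCM)
    have := mul_nonneg hz.le (Complex.normSq_nonneg (z * A + C))
    linarith

theorem congr {g : ℕ → ℂ} (h : IsSectorSeq z N f) (hfg : ∀ i < N, g i = f i) :
    IsSectorSeq z N g := by
  refine ⟨fun i hi => hfg i hi ▸ h.ne_zero i hi, fun i j hij hj => ?_, fun i j hij hj => ?_⟩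
  · rw [hfg i (hij.trans_lt hj), hfg j hj]; exact h.im_nonneg i j hij hj
  · rw [hfg i (hij.trans_lt hj), hfg j hj]; exact h.im_mul_nonneg i j hij hj

end IsSectorSeq

theorem isSectorSeq_pB {z : ℂ} (hz : 0 < z.im) (n : ℕ) :
    IsSectorSeq z (n + 2) (fun k => Polynomial.aeval z (pB n k)) := by
  induction n with
  | zero =>
    have h0 : pB 0 0 = 1 := by rw [pB]
    have h1 : pB 0 1 = Polynomial.X := by rw [pB]
    have hz0 : z ≠ 0 := by rintro rfl; simp at hz
    refine ⟨fun i hi => ?_, fun i j hij hj => ?_, fun i j hij hj => ?_⟩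
    · interval_cases i <;> simp [h0, h1, hz0]
    · interval_cases j <;> interval_cases i <;> simp [h0, h1, hz.le, mul_comm]
    · interval_cases j <;> interval_cases i <;> simp [h0, h1, hz.le, mul_assoc]
      all_goals nlinarith [mul_nonneg hz.le (add_nonneg (mul_self_nonneg z.re) (mul_self_nonneg z.im))]
  | succ n ih =>
    refine (ih.step hz (by omega) (a := fun k => if k = 0 ∨ k = n + 2 then 1 else 2)
      fun k => by split_ifs <;> norm_num).congr fun k hk => ?_
    rw [pB_succ_eq_C_mul n k (by omega), map_mul, Polynomial.aeval_C, map_add, map_mul,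
      Polynomial.aeval_X, map_sum, map_sum]
    rfl

/-- The sum of the arguments of `z - r`, where `r` runs over a multiset of real numbers. -/
noncomputable def argSum (s : Multiset ℝ) (z : ℂ) : ℝ :=
  (s.map fun r : ℝ => (z - r).arg).sum

theorem prod_sub_eq_norm_mul_exp_argSum (s : Multiset ℝ) (z : ℂ) :
    (s.map fun r : ℝ => z - (r : ℂ)).prod =
      ‖(s.map fun r : ℝ => z - (r : ℂ)).prod‖ * Complex.exp (argSum s z * Complex.I) := by
  induction s using Multiset.induction_on with
  | empty => simp [argSum]
  | cons r s ih =>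
    simp only [argSum, Multiset.map_cons, Multiset.prod_cons, Multiset.sum_cons] at ih ⊢
    rw [norm_mul, Complex.ofReal_add, add_mul, Complex.exp_add, Complex.ofReal_mul,
      mul_mul_mul_comm, Complex.norm_mul_exp_arg_mul_I, ← ih]

theorem continuousOn_argSum (s : Multiset ℝ) : ContinuousOn (argSum s) {z | 0 < z.im} := by
  induction s using Multiset.induction_on with
  | empty => exact continuousOn_const
  | cons r s ih =>
    have : argSum (r ::ₘ s) = fun z : ℂ => (z - r).arg + argSum s z := by
      ext z; simp [argSum]
    rw [this]
    refine ContinuousOn.add (fun z hz => ContinuousAt.continuousWithinAt ?_) ih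
    have hz' : 0 < z.im := hz
    exact (Complex.continuousAt_arg (Or.inr (by simpa using hz'.ne'))).comp
      (f := fun z : ℂ => z - r) (continuousAt_id.sub continuousAt_const)

theorem tendsto_arg_add_mul_I {x : ℝ} (hx : x ≠ 0) :
    Tendsto (fun ε : ℝ => ((x : ℂ) + ε * Complex.I).arg) (𝓝[>] 0)
      (𝓝 (if x < 0 then Real.pi else 0)) := by
  have hc : Tendsto (fun ε : ℝ => (x : ℂ) + ε * Complex.I) (𝓝[>] 0) (𝓝 (x : ℂ)) := by
    have : Continuous fun ε : ℝ => (x : ℂ) + ε * Complex.I := by fun_prop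
    simpa using (this.tendsto 0).mono_left nhdsWithin_le_nhds
  split_ifs with h
  · refine (Complex.tendsto_arg_nhdsWithin_im_nonneg_of_re_neg_of_im_zero (z := (x : ℂ))
      (by simpa using h) (by simp)).comp (tendsto_nhdsWithin_iff.2 ⟨hc, ?_⟩)
    filter_upwards [self_mem_nhdsWithin] with ε hε
    simpa using le_of_lt hε
  · have hx' : 0 < x := lt_of_le_of_ne (not_lt.1 h) hx.symm
    have := (Complex.continuousAt_arg (x := (x : ℂ)) (Or.inl (by simpa using hx'))).tendsto.comp hc
    rwa [Complex.arg_ofReal_of_nonneg hx'.le] at this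

theorem tendsto_argSum (s : Multiset ℝ) {t : ℝ} (ht : t ∉ s) :
    Tendsto (fun ε : ℝ => argSum s (t + ε * Complex.I)) (𝓝[>] 0)
      (𝓝 (Real.pi * (s.countP (t < ·) : ℕ))) := by
  induction s using Multiset.induction_on with
  | empty => simp [argSum]
  | cons r s ih =>
    rw [Multiset.mem_cons, not_or] at ht
    have h := (tendsto_arg_add_mul_I (sub_ne_zero.2 ht.1)).add (ih ht.2)
    convert h using 2
    · simp only [argSum, Multiset.map_cons, Multiset.sum_cons]
      congr 2
      push_cast
      ring
    · rw [Multiset.countP_cons]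
      by_cases hr : t < r
      · simp [hr]; ring
      · simp [hr]

theorem IsPreconnected.subset_Icc_of_sin_nonneg {V : Set ℝ} (hV : IsPreconnected V)
    (hsin : ∀ v ∈ V, 0 ≤ Real.sin v) {v₀ : ℝ} (hv₀ : v₀ ∈ V) (h1 : -1 < v₀) (h2 : v₀ < 1) :
    V ⊆ Set.Icc 0 Real.pi := by
  have hpi := Real.pi_gt_three
  have hneg : ∀ x : ℝ, x < 0 → -1 ≤ x → x ∉ V := fun x hx hx1 hxV =>
    (Real.sin_neg_of_neg_of_neg_pi_lt hx (by linarith)).not_ge (hsin x hxV)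
  have hbig : ∀ x : ℝ, Real.pi < x → x ≤ Real.pi + 1 → x ∉ V := fun x hx hx1 hxV => by
    have h3 := hsin x hxV
    have h4 := Real.sin_pos_of_pos_of_lt_pi (sub_pos.2 hx) (by linarith)
    rw [Real.sin_sub_pi] at h4
    linarith
  have h0 : 0 ≤ v₀ := not_lt.1 fun h => hneg v₀ h h1.le hv₀
  have hord := hV.ordConnected
  intro v hv
  refine ⟨not_lt.1 fun h => ?_, not_lt.1 fun h => ?_⟩
  · exact hneg (max v (-1)) (max_lt h (by norm_num)) (le_max_right _ _)
      (hord.out hv hv₀ ⟨le_max_left _ _, max_le (h.le.trans h0) h1.le⟩)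
  · exact hbig (min v (Real.pi + 1)) (lt_min h (by linarith)) (min_le_right _ _)
      (hord.out hv₀ hv ⟨le_min (by linarith) (by linarith), min_le_left _ _⟩)

theorem aeval_eq_mul_exp_argSum {p : Polynomial ℝ} (hp : p.Splits) (z : ℂ) :
    Polynomial.aeval z p = ((p.leadingCoeff * ‖(p.roots.map fun r : ℝ => z - (r : ℂ)).prod‖ : ℝ) : ℂ)
      * Complex.exp (argSum p.roots z * Complex.I) := by
  conv_lhs => rw [hp.eq_prod_roots]
  rw [map_mul, Polynomial.aeval_C, map_multiset_prod, Multiset.map_map, Complex.ofReal_mul,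
    mul_assoc, ← prod_sub_eq_norm_mul_exp_argSum]
  simp

theorem sin_argSum_sub_nonneg {p q : Polynomial ℝ} (hp : p.Splits) (hq : q.Splits)
    (hp0 : 0 < p.leadingCoeff) (hq0 : 0 < q.leadingCoeff) {z : ℂ} (hz : 0 < z.im)
    (h : 0 ≤ (Polynomial.aeval z q * conj (Polynomial.aeval z p)).im) :
    0 ≤ Real.sin (argSum q.roots z - argSum p.roots z) := by
  have hpos : ∀ s : Multiset ℝ, 0 < ‖(s.map fun r : ℝ => z - (r : ℂ)).prod‖ := fun s => by
    refine norm_pos_iff.2 (Multiset.prod_ne_zero fun h0 => ?_)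
    obtain ⟨r, -, hr⟩ := Multiset.mem_map.1 h0
    have := congrArg Complex.im hr
    simp [hz.ne'] at this
  rw [aeval_eq_mul_exp_argSum hp, aeval_eq_mul_exp_argSum hq, map_mul, Complex.conj_ofReal,
    ← Complex.exp_conj, map_mul, Complex.conj_ofReal, Complex.conj_I, mul_mul_mul_comm,
    ← Complex.exp_add, ← Complex.ofReal_mul, Complex.im_ofReal_mul, mul_neg, ← sub_eq_add_neg,
    ← sub_mul, ← Complex.ofReal_sub, Complex.exp_ofReal_mul_I_im] at h
  exact nonneg_of_mul_nonneg_right h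
    (mul_pos (mul_pos hq0 (hpos _)) (mul_pos hp0 (hpos _)))

theorem countP_roots_lt {p q : Polynomial ℝ} (hp : p.Splits) (hq : q.Splits)
    (hp0 : 0 < p.leadingCoeff) (hq0 : 0 < q.leadingCoeff)
    (h : ∀ z : ℂ, 0 < z.im → 0 ≤ (Polynomial.aeval z q * conj (Polynomial.aeval z p)).im)
    {t : ℝ} (htp : t ∉ p.roots) (htq : t ∉ q.roots) :
    p.roots.countP (t < ·) ≤ q.roots.countP (t < ·) ∧
      q.roots.countP (t < ·) ≤ p.roots.countP (t < ·) + 1 := by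
  set D : ℂ → ℝ := fun z => argSum q.roots z - argSum p.roots z with hD
  have hlim : ∀ t : ℝ, t ∉ p.roots → t ∉ q.roots →
      Tendsto (fun ε : ℝ => D (t + ε * Complex.I)) (𝓝[>] 0)
        (𝓝 (Real.pi * (q.roots.countP (t < ·) : ℕ) - Real.pi * (p.roots.countP (t < ·) : ℕ))) :=
    fun t htp htq => (tendsto_argSum _ htq).sub (tendsto_argSum _ htp)
  have hmem : ∀ t ε : ℝ, 0 < ε → (t : ℂ) + ε * Complex.I ∈ {z : ℂ | 0 < z.im} := by
    intro t ε hε; simpa using hε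
  have hpre : IsPreconnected (D '' {z : ℂ | 0 < z.im}) :=
    ((convex_halfSpace_im_gt 0).isPreconnected).image _
      ((continuousOn_argSum _).sub (continuousOn_argSum _))
  obtain ⟨R, hR⟩ : ∃ R : ℝ, ∀ r ∈ p.roots + q.roots, r < R := by
    obtain ⟨M, hM⟩ := (p.roots + q.roots).toFinset.bddAbove
    exact ⟨M + 1, fun r hr => (hM (by simpa using hr)).trans_lt (lt_add_one M)⟩
  have hRp : ∀ r ∈ p.roots, r < R := fun r hr => hR r (Multiset.mem_add.2 (Or.inl hr))
  have hRq : ∀ r ∈ q.roots, r < R := fun r hr => hR r (Multiset.mem_add.2 (Or.inr hr))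
  have h0 := hlim R (fun hr => (hRp R hr).false) (fun hr => (hRq R hr).false)
  rw [Multiset.countP_eq_zero.2 fun r hr => (hRp r hr).not_gt,
    Multiset.countP_eq_zero.2 fun r hr => (hRq r hr).not_gt, sub_self] at h0
  obtain ⟨ε, ⟨hε1, hε2⟩, hε0⟩ :=
    ((h0.eventually (Ioo_mem_nhds (by norm_num : (-1 : ℝ) < 0) one_pos)).and
      self_mem_nhdsWithin).exists
  have hsub := hpre.subset_Icc_of_sin_nonneg
    (by rintro _ ⟨z, hz, rfl⟩; exact sin_argSum_sub_nonneg hp hq hp0 hq0 hz (h z hz))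
    ⟨_, hmem R ε hε0, rfl⟩ hε1 hε2
  have hmemIcc := isClosed_Icc.mem_of_tendsto (hlim t htp htq)
    (by filter_upwards [self_mem_nhdsWithin] with ε hε using hsub ⟨_, hmem t ε hε, rfl⟩)
  rw [← mul_sub] at hmemIcc
  have h1 := nonneg_of_mul_nonneg_right hmemIcc.1 Real.pi_pos
  have h2 : (q.roots.countP (t < ·) : ℝ) - (p.roots.countP (t < ·) : ℕ) ≤ 1 :=
    le_of_mul_le_mul_left (by simpa using hmemIcc.2) Real.pi_pos
  constructor
  · exact_mod_cast sub_nonneg.1 h1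
  · exact_mod_cast (sub_le_iff_le_add'.1 h2)

theorem countP_roots_le {p q : Polynomial ℝ} (hp : p.Splits) (hq : q.Splits)
    (hp0 : 0 < p.leadingCoeff) (hq0 : 0 < q.leadingCoeff)
    (h : ∀ z : ℂ, 0 < z.im → 0 ≤ (Polynomial.aeval z q * conj (Polynomial.aeval z p)).im)
    (t : ℝ) :
    p.roots.countP (t ≤ ·) ≤ q.roots.countP (t ≤ ·) ∧
      q.roots.countP (t ≤ ·) ≤ p.roots.countP (t ≤ ·) + 1 := by
  have hev : ∀ r : ℝ, ∀ᶠ t' in 𝓝[<] t, r ≠ t' ∧ (t ≤ r ↔ t' < r) := by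
    intro r
    rcases lt_or_ge r t with hr | hr
    · filter_upwards [Ioo_mem_nhdsLT hr] with t' ht'
      exact ⟨ht'.1.ne, by simp [hr.not_ge, ht'.1.le]⟩
    · filter_upwards [self_mem_nhdsWithin] with t' ht'
      have ht'' : t' < r := lt_of_lt_of_le ht' hr
      exact ⟨ht''.ne', by simp [hr, ht'']⟩
  obtain ⟨t', ht'⟩ := ((Filter.eventually_all_finset (p.roots + q.roots).toFinset).2
    fun r _ => hev r).exists
  have hP : ∀ r ∈ p.roots, r ≠ t' ∧ (t ≤ r ↔ t' < r) := fun r hr => ht' r (by simp_all)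
  have hQ : ∀ r ∈ q.roots, r ≠ t' ∧ (t ≤ r ↔ t' < r) := fun r hr => ht' r (by simp_all)
  have key := countP_roots_lt hp hq hp0 hq0 h (fun hr => (hP t' hr).1 rfl)
    (fun hr => (hQ t' hr).1 rfl)
  rwa [← Multiset.countP_congr rfl fun r hr => propext (hP r hr).2,
    ← Multiset.countP_congr rfl fun r hr => propext (hQ r hr).2] at key

theorem List.le_get_iff_lt_countP {l : List ℝ} (hl : l.Pairwise (· ≥ ·)) {i : ℕ}
    (hi : i < l.length) (t : ℝ) : t ≤ l.get ⟨i, hi⟩ ↔ i < l.countP (t ≤ ·) := by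
  induction l generalizing i with
  | nil => simp at hi
  | cons a l ih =>
    rw [List.pairwise_cons] at hl
    by_cases hta : t ≤ a
    · rcases i with _ | i
      · simp [hta]
      · simpa [hta] using ih hl.2 (by simpa using hi)
    · have h0 : (a :: l).countP (t ≤ ·) = 0 := by
        refine List.countP_eq_zero.2 fun b hb => ?_
        rcases List.mem_cons.1 hb with rfl | hb
        · simpa using hta
        · simpa using lt_of_le_of_lt (hl.1 b hb) (not_le.1 hta)
      rw [h0]
      simp only [not_lt_zero, iff_false]
      intro h
      rcases List.mem_cons.1 (List.get_mem (a :: l) ⟨i, hi⟩) with hb | hb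
      · exact hta (hb ▸ h)
      · exact hta (h.trans (hl.1 _ hb))

theorem le_rootsDesc_get_iff {p : Polynomial ℝ} {i : ℕ} (hi : i < (rootsDesc p).length) (t : ℝ) :
    t ≤ (rootsDesc p).get ⟨i, hi⟩ ↔ i < p.roots.countP (t ≤ ·) := by
  have hl : (rootsDesc p).Pairwise (· ≥ ·) := by
    rw [rootsDesc, List.pairwise_reverse]
    exact Multiset.pairwise_sort _ _
  have hc : ((rootsDesc p : List ℝ) : Multiset ℝ) = p.roots := by
    rw [rootsDesc, Multiset.coe_reverse, Multiset.sort_eq]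
  rw [List.le_get_iff_lt_countP hl, ← hc, Multiset.coe_countP]

theorem RealRooted.splits {p : Polynomial ℝ} (hp : RealRooted p) : p.Splits := by
  refine Polynomial.Splits.of_splits_map (algebraMap ℝ ℂ) (IsAlgClosed.splits _) fun z hz => ?_
  have h0 : Polynomial.aeval z p = 0 := by
    rw [Polynomial.aeval_def, ← Polynomial.eval_map]
    exact (Polynomial.mem_roots'.1 hz).2
  exact ⟨z.re, Complex.ext rfl (hp z h0).symm⟩

theorem realRooted_of_aeval_ne_zero {p : Polynomial ℝ}
    (hp : ∀ z : ℂ, 0 < z.im → Polynomial.aeval z p ≠ 0) : RealRooted p := by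
  intro z hz
  rcases lt_trichotomy z.im 0 with h | h | h
  · refine absurd ?_ (hp (conj z) (by simpa using h))
    rw [Polynomial.aeval_conj, hz, map_zero]
  · exact h
  · exact absurd hz (hp z h)

theorem roots_nonpos_of_coeff_nonneg {p : Polynomial ℝ} (hp : ∀ m, 0 ≤ p.coeff m) :
    ∀ x ∈ p.roots, x ≤ 0 := by
  intro x hx
  obtain ⟨hp0, hroot⟩ := Polynomial.mem_roots'.1 hx
  by_contra! hx0
  have hpos : 0 < p.eval x := by
    rw [Polynomial.eval_eq_sum_range]
    refine Finset.sum_pos' (fun i _ => mul_nonneg (hp i) (pow_nonneg hx0.le i))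
      ⟨p.natDegree, by simp, mul_pos ?_ (pow_pos hx0 _)⟩
    exact lt_of_le_of_ne (hp _) (Polynomial.leadingCoeff_ne_zero.2 hp0).symm
  exact hpos.ne' hroot

theorem interlaces_of_im_nonneg {p q : Polynomial ℝ} (hp : RealRooted p) (hq : RealRooted q)
    (hp0 : p ≠ 0) (hq0 : q ≠ 0) (hpc : ∀ m, 0 ≤ p.coeff m) (hqc : ∀ m, 0 ≤ q.coeff m)
    (h : ∀ z : ℂ, 0 < z.im → 0 ≤ (Polynomial.aeval z q * conj (Polynomial.aeval z p)).im) :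
    Interlaces p q := by
  have hps := hp.splits
  have hqs := hq.splits
  have hpl : 0 < p.leadingCoeff :=
    lt_of_le_of_ne (hpc _) (Polynomial.leadingCoeff_ne_zero.2 hp0).symm
  have hql : 0 < q.leadingCoeff :=
    lt_of_le_of_ne (hqc _) (Polynomial.leadingCoeff_ne_zero.2 hq0).symm
  have hcount := countP_roots_le hps hqs hpl hql h
  obtain ⟨m, hm⟩ := (p.roots + q.roots).toFinset.bddBelow
  have hmp : p.roots.countP (m ≤ ·) = p.natDegree := by
    rw [Multiset.countP_eq_card.2 fun r hr => hm (by simp_all), hps.natDegree_eq_card_roots]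
  have hmq : q.roots.countP (m ≤ ·) = q.natDegree := by
    rw [Multiset.countP_eq_card.2 fun r hr => hm (by simp_all), hqs.natDegree_eq_card_roots]
  have hdeg := hcount m
  rw [hmp, hmq] at hdeg
  refine ⟨hp0, hq0, hps.natDegree_eq_card_roots.symm, hqs.natDegree_eq_card_roots.symm,
    hdeg.1, hdeg.2, roots_nonpos_of_coeff_nonneg hpc, roots_nonpos_of_coeff_nonneg hqc,
    fun i hip hiq => ?_, fun i hiq hip => ?_⟩
  · exact (le_rootsDesc_get_iff hiq _).2
      (((le_rootsDesc_get_iff hip _).1 le_rfl).trans_le (hcount _).1)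
  · exact (le_rootsDesc_get_iff hip _).2 (Nat.lt_of_succ_lt_succ
      (((le_rootsDesc_get_iff hiq _).1 le_rfl).trans_le (hcount _).2))

/-- For all nonnegative real numbers `c_0, …, c_{n+1}`, not all zero, the polynomial
`∑_{k=0}^{n+1} c_k p^B_{n,k}(x)` is real-rooted and is interlaced by the type `B`
Eulerian polynomial `B_n(x)`, the polynomial determined by
`∑_{m ≥ 0} (2m+1)^n x^m = B_n(x)/(1-x)^{n+1}` in `ℝ⟦x⟧`. -/
theorem pB_nonneg_combination_realRooted (n : ℕ) (c : ℕ → ℝ)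
    (hc : ∀ k ≤ n + 1, 0 ≤ c k) (hc' : ∃ k ≤ n + 1, c k ≠ 0)
    (B : Polynomial ℝ)
    (hB : (B : PowerSeries ℝ) =
      (1 - PowerSeries.X) ^ (n + 1) * PowerSeries.mk (fun m => ((2 * m + 1 : ℝ)) ^ n)) :
    RealRooted (∑ k ∈ Finset.range (n + 2), Polynomial.C (c k) * pB n k) ∧
      Interlaces B (∑ k ∈ Finset.range (n + 2), Polynomial.C (c k) * pB n k) := by
  obtain rfl := pB_zero_eq_of_coe_eq hB
  set q := ∑ k ∈ Finset.range (n + 2), Polynomial.C (c k) * pB n k with hq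
  have haeval : ∀ z : ℂ, Polynomial.aeval z q =
      ∑ k ∈ Finset.range (n + 2), (c k : ℂ) * Polynomial.aeval z (pB n k) := fun z => by
    simp [hq]
  have hc₁ : ∀ k ∈ Finset.range (n + 2), 0 ≤ c k := fun k hk =>
    hc k (Nat.lt_succ_iff.1 (Finset.mem_range.1 hk))
  have hne : ∀ z : ℂ, 0 < z.im → Polynomial.aeval z q ≠ 0 := fun z hz => by
    rw [haeval]
    obtain ⟨k, hk, hck⟩ := hc'
    exact (isSectorSeq_pB hz n).sum_smul_ne_zero hz (fun _ hi => Finset.mem_range.1 hi) hc₁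
      ⟨k, Finset.mem_range.2 (Nat.lt_succ_of_le hk), hck⟩
  have hne₀ : ∀ z : ℂ, 0 < z.im → Polynomial.aeval z (pB n 0) ≠ 0 := fun z hz =>
    (isSectorSeq_pB hz n).ne_zero 0 (by omega)
  have hI : 0 < Complex.I.im := by simp
  refine ⟨realRooted_of_aeval_ne_zero hne, interlaces_of_im_nonneg
    (realRooted_of_aeval_ne_zero hne₀) (realRooted_of_aeval_ne_zero hne)
    (fun h => hne₀ _ hI (by simp [h])) (fun h => hne _ hI (by simp [h]))
    (pB_coeff_nonneg n 0) (fun m => ?_) fun z hz => ?_⟩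
  · rw [hq, Polynomial.finsetSum_coeff]
    refine Finset.sum_nonneg fun k hk => ?_
    rw [Polynomial.coeff_C_mul]
    exact mul_nonneg (hc₁ k hk) (pB_coeff_nonneg n k m)
  · rw [haeval, Finset.sum_mul, Complex.im_sum]
    refine Finset.sum_nonneg fun k hk => ?_
    rw [mul_assoc, Complex.im_ofReal_mul]
    exact mul_nonneg (hc₁ k hk)
      ((isSectorSeq_pB hz n).im_nonneg 0 k (Nat.zero_le k) (Finset.mem_range.1 hk))
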